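/- For every integer z ≠ 0 and every integer h ≥ 0, every path starting on the x-axis and ending at the vertex (z, h) has total passage time at least min(2h, h + 2|z|). -/

import Mathlib

/-- Two lattice points are adjacent iff they differ by 1 in exactly one coordinate. -/
def LatticeAdj (p q : ℤ × ℤ) : Prop := |p.1 - q.1| + |p.2 - q.2| = 1

/-- The passage time of the edge between `p` and `q`: 1 if both endpoints lie on the
y-axis, and 2 otherwise. -/
def edgeTime (p q : ℤ × ℤ) : ℤ := if p.1 = 0 ∧ q.1 = 0 then 1 else 2

/-- `π : Fin (n+1) → ℤ × ℤ` is a path if consecutive vertices are adjacent. -/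
def IsLatticePath (n : ℕ) (π : Fin (n + 1) → ℤ × ℤ) : Prop :=
  ∀ i : Fin n, LatticeAdj (π i.castSucc) (π i.succ)

/-- The total passage time of a path. -/
def totalTime (n : ℕ) (π : Fin (n + 1) → ℤ × ℤ) : ℤ :=
  ∑ i : Fin n, edgeTime (π i.castSucc) (π i.succ)

theorem pot_step (p q : ℤ × ℤ) (h : LatticeAdj p q) :
    min (2 * |q.2|) (|q.2| + 2 * |q.1|) ≤
      min (2 * |p.2|) (|p.2| + 2 * |p.1|) + edgeTime p q := by
  obtain ⟨a, b⟩ := p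
  obtain ⟨c, d⟩ := q
  simp only [LatticeAdj, edgeTime] at *
  split_ifs with h0
  · obtain ⟨rfl, rfl⟩ := h0
    simp only [abs_eq_max_neg] at *
    omega
  · simp only [abs_eq_max_neg] at *
    omega

theorem pot_le (n : ℕ) (π : Fin (n + 1) → ℤ × ℤ)
    (hpath : IsLatticePath n π) (hstart : (π 0).2 = 0) :
    min (2 * |(π (Fin.last n)).2|) (|(π (Fin.last n)).2| + 2 * |(π (Fin.last n)).1|)
      ≤ totalTime n π := by
  induction n with
  | zero => simp [totalTime, hstart]
  | succ n ih =>
    have h1 := ih (fun i => π i.castSucc) (fun i => hpath i.castSucc) hstart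
    have h2 := pot_step _ _ (hpath (Fin.last n))
    have h3 : totalTime (n + 1) π = totalTime n (fun i => π i.castSucc)
        + edgeTime (π (Fin.last n).castSucc) (π (Fin.last n).succ) := by
      unfold totalTime
      rw [Fin.sum_univ_castSucc]
      rfl
    rw [h3]
    rw [Fin.succ_last] at *
    linarith


/-- For every integer z ≠ 0 and every integer h ≥ 0, every path starting on
the x-axis and ending at the vertex (z, h) has total passage time at least
min(2h, h + 2|z|). -/
theorem stmt_14 (z h : ℤ) (hz : z ≠ 0) (hh : 0 ≤ h)
    (n : ℕ) (π : Fin (n + 1) → ℤ × ℤ)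
    (hpath : IsLatticePath n π) (hstart : (π 0).2 = 0)
    (hend : π (Fin.last n) = (z, h)) :
    min (2 * h) (h + 2 * |z|) ≤ totalTime n π := by
  have := pot_le n π hpath hstart
  rw [hend] at this
  simpa only [abs_of_nonneg hh] using this
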